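/- arXiv:2604.27628 — 2 statements merged into one kernel-verified Lean document; each statement's English description precedes it below -/
import Mathlib

section
/- Let s ∈ (0,1) and α ∈ (s, 1+s). Then P.V. ∫_ℝ (1 − |t|^α)/|1 − t|^{2+s} dt < 0, where the principal value is taken by excising the interval (1−ε, 1+ε) and letting ε → 0⁺. -/
open MeasureTheory Filter

/-- the integrand -/
noncomputable def pvF (s α t : ℝ) : ℝ := (1 - |t| ^ α) / |1 - t| ^ (2 + s)

/-- the integrand after inversion -/
noncomputable def pvH (s α t : ℝ) : ℝ := (|t| ^ s - |t| ^ (s - α)) / |1 - t| ^ (2 + s)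

lemma pv_abs_rpow_intervalIntegrable (r a b : ℝ) (hr : -1 < r) :
    IntervalIntegrable (fun x : ℝ => |x| ^ r) volume a b := by
  have pos : ∀ c : ℝ, 0 ≤ c → IntervalIntegrable (fun x : ℝ => |x| ^ r) volume 0 c := by
    intro c hc
    refine (intervalIntegral.intervalIntegrable_rpow' (a := 0) (b := c) hr).congr ?_
    intro x hx
    rw [Set.uIoc_of_le hc] at hx
    simp only
    rw [abs_of_pos hx.1]
  have all : ∀ c : ℝ, IntervalIntegrable (fun x : ℝ => |x| ^ r) volume 0 c := by
    intro c
    rcases le_total 0 c with hc | hc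
    · exact pos c hc
    · rw [IntervalIntegrable.iff_comp_neg]
      simpa using pos (-c) (by linarith)
  exact (all a).symm.trans (all b)

lemma pv_kernel_cont (s a b : ℝ) (ha : a < 1) (hb : b < 1) :
    ContinuousOn (fun t : ℝ => (|1 - t| ^ (2 + s))⁻¹) (Set.uIcc a b) := by
  intro x hx
  have hx1 : x < 1 := lt_of_le_of_lt hx.2 (max_lt ha hb)
  have h : |1 - x| ≠ 0 := by
    rw [abs_of_pos (by linarith)]; linarith
  refine ContinuousAt.continuousWithinAt ?_
  refine ContinuousAt.inv₀ ?_ ?_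
  · exact ContinuousAt.rpow (by fun_prop) (by fun_prop) (Or.inl h)
  · exact (Real.rpow_pos_of_pos (lt_of_le_of_ne (abs_nonneg _) h.symm) _).ne'

lemma pvF_int (s α a b : ℝ) (hα : -1 < α) (ha : a < 1) (hb : b < 1) :
    IntervalIntegrable (pvF s α) volume a b := by
  have h := (((_root_.intervalIntegrable_const (c := (1:ℝ)) (μ := volume) (a := a) (b := b))).sub
    (pv_abs_rpow_intervalIntegrable α a b hα)).mul_continuousOn (pv_kernel_cont s a b ha hb)
  refine h.congr ?_
  intro x _
  simp [pvF, div_eq_mul_inv]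

lemma pvH_int (s α a b : ℝ) (hs : -1 < s) (hα : -1 < s - α) (ha : a < 1) (hb : b < 1) :
    IntervalIntegrable (pvH s α) volume a b := by
  have h := ((pv_abs_rpow_intervalIntegrable s a b hs).sub
    (pv_abs_rpow_intervalIntegrable (s - α) a b hα)).mul_continuousOn (pv_kernel_cont s a b ha hb)
  refine h.congr ?_
  intro x _
  simp [pvH, div_eq_mul_inv]

lemma pvG_eq (s α t : ℝ) (ht : t ≠ 0) :
    pvF s α t + pvH s α t = (1 - |t| ^ α) * (1 - |t| ^ (s - α)) / |1 - t| ^ (2 + s) := by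
  unfold pvF pvH
  have : |t| ^ s = |t| ^ α * |t| ^ (s - α) := by
    rw [← Real.rpow_add (abs_pos.2 ht)]; congr 1; ring
  rw [← add_div, this]; congr 1; ring

lemma pv_bounds (s α a : ℝ) (hs : s ∈ Set.Ioo (0:ℝ) 1) (hα : α ∈ Set.Ioo s (1 + s))
    (ha : 1 / 2 ≤ a) (ha1 : a ≤ 1) :
    0 ≤ 1 - a ^ α ∧ 1 - a ^ α ≤ 2 * (1 - a) ∧ 0 ≤ a ^ (s - α) - 1 ∧
      a ^ (s - α) - 1 ≤ 2 * (1 - a) := by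
  obtain ⟨h0, h1⟩ := hs
  obtain ⟨h2, h3⟩ := hα
  have hp : 0 < a := by linarith
  refine ⟨?_, ?_, ?_, ?_⟩
  · linarith [Real.rpow_le_one hp.le ha1 (by linarith : 0 ≤ α)]
  · have := Real.rpow_le_rpow_of_exponent_ge hp ha1 (by linarith : α ≤ (2:ℝ))
    rw [Real.rpow_two] at this
    nlinarith
  · linarith [Real.one_le_rpow_of_pos_of_le_one_of_nonpos hp ha1 (by linarith : s - α ≤ 0)]
  · have := Real.rpow_le_rpow_of_exponent_ge hp ha1 (by linarith : (-1:ℝ) ≤ s - α)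
    rw [Real.rpow_neg_one] at this
    have h : a⁻¹ ≤ 1 + 2 * (1 - a) := by
      rw [inv_le_iff_one_le_mul₀ hp]; nlinarith
    linarith

lemma pvH_bound (s α t : ℝ) (hs : s ∈ Set.Ioo (0:ℝ) 1) (hα : α ∈ Set.Ioo s (1 + s))
    (ha : 1 / 2 ≤ t) (ha1 : t < 1) : ‖pvH s α t‖ ≤ 4 * (1 - t) ^ (-1 - s) := by
  obtain ⟨b1, b2, b3, b4⟩ := pv_bounds s α t hs hα ha ha1.le
  have hp : 0 < t := by linarith
  have h1 : 0 < 1 - t := by linarith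
  unfold pvH
  rw [norm_div, Real.norm_eq_abs, Real.norm_eq_abs, abs_of_pos hp, abs_of_pos h1,
    abs_of_pos (Real.rpow_pos_of_pos h1 _), div_le_iff₀ (Real.rpow_pos_of_pos h1 _), mul_assoc,
    ← Real.rpow_add h1]
  have e : -1 - s + (2 + s) = 1 := by ring
  rw [e, Real.rpow_one]
  have : t ^ s = t ^ α * t ^ (s - α) := by
    rw [← Real.rpow_add hp]; congr 1; ring
  rw [this, abs_le]
  constructor <;> nlinarith

lemma pvG_bound (s α t : ℝ) (hs : s ∈ Set.Ioo (0:ℝ) 1) (hα : α ∈ Set.Ioo s (1 + s))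
    (ha : 1 / 2 ≤ t) (ha1 : t < 1) : ‖pvF s α t + pvH s α t‖ ≤ 4 * (1 - t) ^ (-s) := by
  obtain ⟨b1, b2, b3, b4⟩ := pv_bounds s α t hs hα ha ha1.le
  have hp : 0 < t := by linarith
  have h1 : 0 < 1 - t := by linarith
  rw [pvG_eq s α t hp.ne', norm_div, Real.norm_eq_abs, Real.norm_eq_abs, abs_of_pos hp,
    abs_of_pos h1,
    abs_of_pos (Real.rpow_pos_of_pos h1 _), div_le_iff₀ (Real.rpow_pos_of_pos h1 _), mul_assoc,
    ← Real.rpow_add h1]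
  have e : -s + (2 + s) = 2 := by ring
  rw [e, Real.rpow_two, abs_le]
  have := mul_le_mul b2 b4 b3 (by linarith)
  constructor <;> nlinarith

lemma pvG_int (s α : ℝ) (hs : s ∈ Set.Ioo (0:ℝ) 1) (hα : α ∈ Set.Ioo s (1 + s)) :
    IntervalIntegrable (fun t => pvF s α t + pvH s α t) volume (-1) 1 := by
  obtain ⟨h0, h1⟩ := hs
  obtain ⟨h2, h3⟩ := hα
  have A : IntervalIntegrable (fun t => pvF s α t + pvH s α t) volume (-1) (1/2) :=
    (pvF_int s α _ _ (by linarith) (by norm_num) (by norm_num)).add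
      (pvH_int s α _ _ (by linarith) (by linarith) (by norm_num) (by norm_num))
  refine A.trans ?_
  have B : IntervalIntegrable (fun t : ℝ => 4 * (1 - t) ^ (-s)) volume (1/2) 1 := by
    have := (intervalIntegral.intervalIntegrable_rpow' (a := 1/2) (b := 0)
      (by linarith : -1 < -s)).comp_sub_left 1
    norm_num at this
    exact this.const_mul 4
  refine B.mono_fun' ?_ ?_
  · apply Measurable.aestronglyMeasurable
    unfold pvF pvH
    fun_prop
  · rw [Set.uIoc_of_le (by norm_num)]
    have : ∀ᵐ x : ℝ ∂(volume.restrict (Set.Ioc (1/2) 1)), x ≠ 1 :=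
      ae_restrict_of_ae (by simp [ae_iff])
    filter_upwards [this, ae_restrict_mem measurableSet_Ioc] with x hx1 hx
    exact pvG_bound s α x ⟨h0, h1⟩ ⟨h2, h3⟩ hx.1.le (lt_of_le_of_ne hx.2 hx1)

lemma pvG_neg (s α t : ℝ) (hs : s ∈ Set.Ioo (0:ℝ) 1) (hα : α ∈ Set.Ioo s (1 + s))
    (ht : t ≠ 0) (h1 : -1 < t) (h2 : t < 1) : pvF s α t + pvH s α t < 0 := by
  rw [pvG_eq s α t ht]
  have ha := abs_pos.2 ht
  have hb : |t| < 1 := abs_lt.2 ⟨h1, h2⟩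
  obtain ⟨h3, h4⟩ := hs
  obtain ⟨h5, h6⟩ := hα
  have e1 := Real.rpow_lt_one ha.le hb (by linarith : 0 < α)
  have e2 := Real.one_lt_rpow_of_pos_of_lt_one_of_neg ha hb (by linarith : s - α < 0)
  refine div_neg_of_neg_of_pos ?_ (Real.rpow_pos_of_pos (abs_pos.2 (by linarith)) _)
  nlinarith

lemma pv_L_neg (s α : ℝ) (hs : s ∈ Set.Ioo (0:ℝ) 1) (hα : α ∈ Set.Ioo s (1 + s)) :
    ∫ t in (-1:ℝ)..1, (pvF s α t + pvH s α t) < 0 := by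
  have hi := pvG_int s α hs hα
  have i1 : IntervalIntegrable (fun t => pvF s α t + pvH s α t) volume (-1) 0 :=
    hi.mono_set (by rw [Set.uIcc_of_le, Set.uIcc_of_le] <;> [skip; norm_num; norm_num]
                    exact Set.Icc_subset_Icc (by norm_num) (by norm_num))
  have i2 : IntervalIntegrable (fun t => pvF s α t + pvH s α t) volume 0 1 :=
    hi.mono_set (by rw [Set.uIcc_of_le, Set.uIcc_of_le] <;> [skip; norm_num; norm_num]
                    exact Set.Icc_subset_Icc (by norm_num) (by norm_num))
  rw [← intervalIntegral.integral_add_adjacent_intervals i1 i2]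
  have p1 := intervalIntegral.intervalIntegral_pos_of_pos_on i1.neg (fun x hx => by
    have := pvG_neg s α x hs hα hx.2.ne hx.1 (by linarith [hx.2])
    exact neg_pos.2 this) (by norm_num)
  have p2 := intervalIntegral.intervalIntegral_pos_of_pos_on i2.neg (fun x hx => by
    have := pvG_neg s α x hs hα hx.1.ne' (by linarith [hx.1]) hx.2
    exact neg_pos.2 this) (by norm_num)
  simp only [Pi.neg_apply, intervalIntegral.integral_neg] at p1 p2
  linarith

lemma pv_inv_eq (s α u : ℝ) (hu : u ≠ 0) :
    |(-(u ^ 2)⁻¹)| • pvF s α u⁻¹ = pvH s α u := by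
  have ha := abs_pos.2 hu
  unfold pvF pvH
  have e : |1 - u⁻¹| = |1 - u| / |u| := by
    rw [← abs_div, ← abs_neg]; congr 1; field_simp; ring
  rw [e, Real.div_rpow (abs_nonneg _) ha.le, abs_neg, abs_inv, abs_inv, abs_pow,
    Real.inv_rpow ha.le, Real.rpow_sub ha, Real.rpow_add ha, Real.rpow_two, smul_eq_mul]
  have := (Real.rpow_pos_of_pos ha α).ne'
  have := (Real.rpow_pos_of_pos ha s).ne'
  field_simp

lemma pv_identity (s α ε : ℝ) (hs : s ∈ Set.Ioo (0:ℝ) 1) (hα : α ∈ Set.Ioo s (1 + s))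
    (hε : 0 < ε) (hε1 : ε < 1) :
    ∫ t in (Set.Ioo (1 - ε) (1 + ε))ᶜ, pvF s α t =
      (∫ t in (-1:ℝ)..(1 - ε), (pvF s α t + pvH s α t)) +
        ∫ t in (1 - ε)..(1 + ε)⁻¹, pvH s α t := by
  obtain ⟨h0, h1⟩ := hs
  obtain ⟨h2, h3⟩ := hα
  have hb : (1 + ε)⁻¹ < 1 := inv_lt_one_of_one_lt₀ (by linarith)
  have hb0 : 0 < (1 + ε)⁻¹ := by positivity
  set T : Set ℝ := Set.Ioc (-1) (1 + ε)⁻¹ \ {0} with hT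
  have hTm : MeasurableSet T := measurableSet_Ioc.diff (measurableSet_singleton 0)
  have hTae : T =ᵐ[volume] Set.Ioc (-1) (1 + ε)⁻¹ := sdiff_null_ae_eq_self (by simp)
  have hder : ∀ x ∈ T, HasDerivWithinAt (fun x : ℝ => x⁻¹) (-(x ^ 2)⁻¹) T x :=
    fun x hx => (hasDerivAt_inv hx.2).hasDerivWithinAt
  have hinj : Set.InjOn (fun x : ℝ => x⁻¹) T := inv_injective.injOn
  have hset : (Set.Ioo (1 - ε) (1 + ε))ᶜ = (fun x : ℝ => x⁻¹) '' T ∪ Set.Icc (-1) (1 - ε) := by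
    ext t
    simp only [Set.mem_compl_iff, Set.mem_Ioo, Set.mem_union, Set.mem_image, Set.mem_Icc, hT,
      Set.mem_sdiff, Set.mem_Ioc, Set.mem_singleton_iff]
    constructor
    · intro h
      by_cases hc : -1 ≤ t ∧ t ≤ 1 - ε
      · exact Or.inr hc
      · left
        refine ⟨t⁻¹, ?_, inv_inv t⟩
        rcases lt_or_ge t (-1) with ht | ht
        · have hn : t⁻¹ < 0 := inv_lt_zero.2 (by linarith)
          have hm : t * t⁻¹ = 1 := mul_inv_cancel₀ (by linarith)
          exact ⟨⟨by nlinarith, by linarith⟩, hn.ne⟩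
        · have ht2 : 1 + ε ≤ t := by
            by_contra hcc
            push Not at hcc hc
            exact h ⟨hc ht, hcc⟩
          have hp : 0 < t⁻¹ := inv_pos.2 (by linarith)
          exact ⟨⟨by linarith, inv_anti₀ (by linarith) ht2⟩, hp.ne'⟩
    · rintro (⟨u, ⟨⟨hu1, hu2⟩, hu0⟩, rfl⟩ | ⟨h, h'⟩) ⟨h4, h5⟩
      · have hip : 0 < u⁻¹ := by linarith
        have hup : 0 < u := inv_pos.1 hip
        have := inv_anti₀ hup hu2
        rw [inv_inv] at this
        linarith
      · linarith
  have hdisj : Disjoint ((fun x : ℝ => x⁻¹) '' T) (Set.Icc (-1) (1 - ε)) := by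
    rw [Set.disjoint_left]
    rintro _ ⟨u, ⟨⟨hu1, hu2⟩, hu0⟩, rfl⟩ ⟨h4, h5⟩
    simp only at h4 h5
    have hm : u * u⁻¹ = 1 := mul_inv_cancel₀ hu0
    rcases lt_or_gt_of_ne (show u ≠ 0 from hu0) with hn | hp
    · have : u⁻¹ < 0 := inv_lt_zero.2 hn
      nlinarith
    · have := inv_anti₀ hp hu2
      rw [inv_inv] at this
      linarith
  have hcongr : Set.EqOn (fun x : ℝ => |(-(x ^ 2)⁻¹)| • pvF s α x⁻¹) (pvH s α) T :=
    fun x hx => pv_inv_eq s α x hx.2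
  have hHi : ∀ a b : ℝ, a < 1 → b < 1 → IntervalIntegrable (pvH s α) volume a b :=
    fun a b ha hb => pvH_int s α a b (by linarith) (by linarith) ha hb
  have hFi : IntervalIntegrable (pvF s α) volume (-1) (1 - ε) :=
    pvF_int s α _ _ (by linarith) (by norm_num) (by linarith)
  have hHT : IntegrableOn (pvH s α) T :=
    (((intervalIntegrable_iff_integrableOn_Ioc_of_le (by linarith)).1
      (hHi (-1) (1 + ε)⁻¹ (by norm_num) hb))).mono_set Set.sdiff_subset
  have hint1 : IntegrableOn (pvF s α) ((fun x : ℝ => x⁻¹) '' T) := by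
    rw [integrableOn_image_iff_integrableOn_abs_deriv_smul hTm hder hinj]
    exact hHT.congr_fun hcongr.symm hTm
  have hint2 : IntegrableOn (pvF s α) (Set.Icc (-1) (1 - ε)) :=
    (intervalIntegrable_iff_integrableOn_Icc_of_le (by linarith)).1 hFi
  rw [hset, setIntegral_union hdisj measurableSet_Icc hint1 hint2,
    integral_image_eq_integral_abs_deriv_smul hTm hder hinj,
    setIntegral_congr_fun hTm hcongr, setIntegral_congr_set hTae, integral_Icc_eq_integral_Ioc,
    ← intervalIntegral.integral_of_le (by linarith), ← intervalIntegral.integral_of_le (by linarith),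
    intervalIntegral.integral_add hFi (hHi _ _ (by norm_num) (by linarith)),
    ← intervalIntegral.integral_add_adjacent_intervals
      (hHi (-1) (1 - ε) (by norm_num) (by linarith)) (hHi (1 - ε) (1 + ε)⁻¹ (by linarith) hb)]
  ring

lemma pv_err_bound (s α ε : ℝ) (hs : s ∈ Set.Ioo (0:ℝ) 1) (hα : α ∈ Set.Ioo s (1 + s))
    (hε : 0 < ε) (hε1 : ε < 1 / 2) :
    ‖∫ t in (1 - ε)..(1 + ε)⁻¹, pvH s α t‖ ≤ 4 * (1 / 2) ^ (-1 - s) * ε ^ (1 - s) := by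
  have hinv : (1 + ε) * (1 + ε)⁻¹ = 1 := mul_inv_cancel₀ (by linarith)
  have hb0 : 0 < (1 + ε)⁻¹ := by positivity
  set b := (1 + ε)⁻¹ with hbdef
  have hle : 1 - ε ≤ b := by nlinarith
  have hb2 : b ≤ 1 - ε / 2 := by nlinarith
  have hlen : b - (1 - ε) ≤ ε ^ 2 := by nlinarith
  have h := intervalIntegral.norm_integral_le_of_norm_le_const (a := 1 - ε) (b := b)
    (f := pvH s α) (C := 4 * (1 / 2 * ε) ^ (-1 - s)) (by
      intro x hx
      rw [Set.uIoc_of_le hle] at hx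
      refine (pvH_bound s α x hs hα (by linarith [hx.1]) (by linarith [hx.2])).trans ?_
      have := Real.rpow_le_rpow_of_nonpos (by linarith : 0 < 1 / 2 * ε)
        (by linarith [hx.2] : 1 / 2 * ε ≤ 1 - x) (by linarith [hs.1] : -1 - s ≤ 0)
      linarith)
  refine h.trans ?_
  rw [abs_of_nonneg (by linarith), Real.mul_rpow (by norm_num) hε.le]
  have e : ε ^ (1 - s) = ε ^ (-1 - s) * ε ^ 2 := by
    rw [← Real.rpow_two, ← Real.rpow_add hε]; congr 1; ring
  rw [e]
  calc _ ≤ 4 * ((1 / 2) ^ (-1 - s) * ε ^ (-1 - s)) * ε ^ 2 := by gcongr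
    _ = _ := by ring

theorem pv_integral_neg (s α : ℝ) (hs : s ∈ Set.Ioo (0:ℝ) 1)
    (hα : α ∈ Set.Ioo s (1 + s)) :
    ∃ L : ℝ, L < 0 ∧
      Tendsto (fun ε : ℝ =>
          ∫ t in (Set.Ioo (1 - ε) (1 + ε))ᶜ, (1 - |t| ^ α) / |1 - t| ^ (2 + s))
        (nhdsWithin 0 (Set.Ioi 0)) (nhds L) := by
  refine ⟨_, pv_L_neg s α hs hα, ?_⟩
  have hev : ∀ᶠ ε : ℝ in nhdsWithin 0 (Set.Ioi 0), ε ∈ Set.Ioo (0:ℝ) (1 / 2) :=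
    Ioo_mem_nhdsGT (by norm_num)
  have herr : Tendsto (fun ε : ℝ => ∫ t in (1 - ε)..(1 + ε)⁻¹, pvH s α t)
      (nhdsWithin 0 (Set.Ioi 0)) (nhds 0) := by
    refine squeeze_zero_norm' (hev.mono fun ε hε => pv_err_bound s α ε hs hα hε.1 hε.2) ?_
    have : Tendsto (fun ε : ℝ => 4 * (1 / 2 : ℝ) ^ (-1 - s) * ε ^ (1 - s)) (nhds 0)
        (nhds (4 * (1 / 2 : ℝ) ^ (-1 - s) * 0 ^ (1 - s))) :=
      (Real.continuousAt_rpow_const 0 (1 - s) (Or.inr (by linarith [hs.2]))).tendsto.const_mul _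
    rw [Real.zero_rpow (by linarith [hs.2]), mul_zero] at this
    exact this.mono_left nhdsWithin_le_nhds
  have hmain : Tendsto (fun ε : ℝ => ∫ t in (-1:ℝ)..(1 - ε), (pvF s α t + pvH s α t))
      (nhdsWithin 0 (Set.Ioi 0)) (nhds (∫ t in (-1:ℝ)..1, (pvF s α t + pvH s α t))) := by
    have hc := intervalIntegral.continuousOn_primitive_interval
      ((intervalIntegrable_iff' (by simp)).1 (pvG_int s α hs hα))
    refine (hc 1 Set.right_mem_uIcc).tendsto.comp ?_
    refine tendsto_nhdsWithin_iff.2 ⟨?_, ?_⟩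
    · have : Tendsto (fun ε : ℝ => 1 - ε) (nhds 0) (nhds (1 - 0)) :=
        (continuous_const.sub continuous_id).tendsto 0
      rw [sub_zero] at this
      exact this.mono_left nhdsWithin_le_nhds
    · filter_upwards [hev] with ε hε
      rw [Set.uIcc_of_le (by norm_num)]
      exact ⟨by linarith [hε.2], by linarith [hε.1]⟩
  have hsum := hmain.add herr
  rw [add_zero] at hsum
  refine hsum.congr' ?_
  filter_upwards [hev] with ε hε
  exact (pv_identity s α ε hs hα hε.1 (by linarith [hε.2])).symm
end

section
/- Let n ≥ 2, s ∈ (0,1), α ∈ (0,1), and let F = {(x', x_{n+1}) ∈ ℝⁿ × ℝ : x_{n+1} < |x'|^α}. There exists a constant C ≥ 1 depending only on n, s, α such that for every point x ∈ ∂F with |x| ≥ 1, the fractional s-mean curvature satisfies |H_{s,F}(x)| ≤ C |x|^{α−1−s}. -/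
open MeasureTheory Filter

/-- The integrand in the definition of the fractional `s`-mean curvature of `A` at `x`. -/
noncomputable def nmcIntegrand (n : ℕ) (s : ℝ) (A : Set (EuclideanSpace ℝ (Fin (n + 1))))
    (x y : EuclideanSpace ℝ (Fin (n + 1))) : ℝ :=
  (Set.indicator Aᶜ (fun _ => (1:ℝ)) y - Set.indicator A (fun _ => (1:ℝ)) y) *
    ‖x - y‖ ^ (-((n : ℝ) + 1 + s))

/-- `H_{s,A}(x)` exists in the principal-value sense and equals `L`. -/
def HasFracMeanCurv (n : ℕ) (s : ℝ) (A : Set (EuclideanSpace ℝ (Fin (n + 1))))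
    (x : EuclideanSpace ℝ (Fin (n + 1))) (L : ℝ) : Prop :=
  Tendsto (fun ε : ℝ => ∫ y in (Metric.ball x ε)ᶜ, nmcIntegrand n s A x y)
    (nhdsWithin 0 (Set.Ioi 0)) (nhds L)

/-- The subgraph of `x' ↦ |x'|^α` in `ℝ^{n+1}`, with `x' = (x_1, …, x_n)` and vertical
coordinate `x_{n+1}`. -/
noncomputable def powerSubgraph (n : ℕ) (α : ℝ) : Set (EuclideanSpace ℝ (Fin (n + 1))) :=
  {x | x (Fin.last n) <
    (Real.sqrt (∑ i : Fin n, (x i.castSucc) ^ 2)) ^ α}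

lemma rpow_taylor {w β : ℝ} (hw : 0 ≤ w) (h0 : 0 < β) (h1 : β ≤ 1) :
    |w ^ β - 1 - β * (w - 1)| ≤ (w - 1) ^ 2 := by
  have hu : w ^ β ≤ 1 + β * (w - 1) := by
    have := rpow_one_add_le_one_add_mul_self (s := w - 1) (by linarith) h0.le h1
    simpa using this
  have hl : 1 + β * (w - 1) - (1 - β) * (w - 1) ^ 2 ≤ w ^ β := by
    have h2 := rpow_one_add_le_one_add_mul_self (s := w - 1) (by linarith) (p := 1 - β)
      (by linarith) (by linarith)
    rw [add_sub_cancel] at h2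
    rcases hw.eq_or_lt with rfl | hw
    · rw [Real.zero_rpow h0.ne']; nlinarith
    · have hp : 0 < w ^ (1 - β) := Real.rpow_pos_of_pos hw _
      have hq : 0 < w ^ β := Real.rpow_pos_of_pos hw _
      have hm : w ^ β * w ^ (1 - β) = w := by
        rw [← Real.rpow_add hw]; simp
      set D := 1 + (1 - β) * (w - 1) with hD
      have hDp : 0 < D := lt_of_lt_of_le hp h2
      have h3 : w ≤ w ^ β * D := by
        calc w = w ^ β * w ^ (1 - β) := hm.symm
          _ ≤ _ := by gcongr
      have h4 : (1 + β * (w - 1) - (1 - β) * (w - 1) ^ 2) * D ≤ w := by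
        have : w - (1 + β * (w - 1) - (1 - β) * (w - 1) ^ 2) * D
          = w * ((1 - β) * (w - 1)) ^ 2 := by rw [hD]; ring
        nlinarith [mul_nonneg hw.le (sq_nonneg ((1 - β) * (w - 1)))]
      exact le_of_mul_le_mul_right (h4.trans h3) hDp
  rw [abs_le]
  constructor <;> nlinarith [sq_nonneg (w - 1)]

lemma tangent_bound {V : Type*} [NormedAddCommGroup V] [InnerProductSpace ℝ V] {α : ℝ}
    (h0 : 0 < α) (h1 : α < 1) (p q : V) (hp : 0 < ‖p‖) :
    |‖q‖ ^ α - ‖p‖ ^ α - α * ‖p‖ ^ (α - 2) * inner ℝ p (q - p)| ≤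
      10 * ‖p‖ ^ (α - 2) * (‖q - p‖ * min ‖q - p‖ ‖p‖) := by
  set r := ‖p‖ with hr
  set t := ‖q - p‖ with ht
  set I := inner ℝ p (q - p) with hI
  have ht0 : 0 ≤ t := norm_nonneg _
  have hIb : |I| ≤ r * t := abs_real_inner_le_norm _ _
  have hA : 0 < r ^ (α - 2) := Real.rpow_pos_of_pos hp _
  set A := r ^ (α - 2) with hAdef
  have hrα : r ^ α = A * r ^ 2 := by
    rw [hAdef, ← Real.rpow_natCast r 2, ← Real.rpow_add hp]; norm_num
  have hq2 : ‖q‖ ^ 2 = r ^ 2 + 2 * I + t ^ 2 := by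
    have : q = p + (q - p) := by abel
    conv_lhs => rw [this]
    exact norm_add_sq_real p (q - p)
  have hqt : ‖q‖ ≤ r + t := by
    have : q = p + (q - p) := by abel
    conv_lhs => rw [this]
    exact norm_add_le _ _
  rcases le_total t r with htr | htr
  · rw [min_eq_left htr]
    set w := (‖q‖ / r) ^ 2 with hw
    have hwα : ‖q‖ ^ α = A * r ^ 2 * w ^ (α / 2) := by
      rw [hw, ← Real.rpow_natCast (‖q‖ / r) 2, ← Real.rpow_mul (by positivity), Real.div_rpow (by positivity) hp.le,
        ← hrα]
      rw [show ((2:ℕ):ℝ) * (α/2) = α by push_cast; ring]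
      have : r ^ α ≠ 0 := (Real.rpow_pos_of_pos hp _).ne'
      field_simp
    have h := rpow_taylor (w := w) (by positivity) (half_pos h0) (by linarith)
    have hw1 : r ^ 2 * (w - 1) = 2 * I + t ^ 2 := by
      rw [hw, div_pow, mul_sub, mul_div_cancel₀ _ (by positivity), hq2]; ring
    have hw1' : |r ^ 2 * (w - 1)| ≤ 3 * (r * t) := by
      rw [hw1]
      calc |2 * I + t ^ 2| ≤ |2 * I| + |t ^ 2| := abs_add_le _ _
        _ = 2 * |I| + t ^ 2 := by rw [abs_mul, abs_of_nonneg (sq_nonneg t)]; norm_num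
        _ ≤ _ := by nlinarith
    have hw2 : r ^ 2 * (w - 1) ^ 2 ≤ 9 * t ^ 2 := by
      have := sq_le_sq' (abs_le.1 hw1').1 (abs_le.1 hw1').2
      have h5 : r ^ 2 * (r ^ 2 * (w - 1) ^ 2) ≤ r ^ 2 * (9 * t ^ 2) := by nlinarith
      exact le_of_mul_le_mul_left h5 (by positivity)
    have key : ‖q‖ ^ α - r ^ α - α * A * I =
        A * (r ^ 2 * (w ^ (α / 2) - 1 - α / 2 * (w - 1)) + α / 2 * t ^ 2) := by
      rw [hwα, hrα]
      linear_combination (α / 2 * A) * hw1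
    rw [key, abs_mul, abs_of_pos hA, mul_comm 10 A, mul_assoc]
    refine mul_le_mul_of_nonneg_left ?_ hA.le
    refine (abs_add_le _ _).trans ?_
    rw [abs_mul, abs_of_nonneg (sq_nonneg r), abs_of_nonneg (by positivity : 0 ≤ α / 2 * t ^ 2)]
    have : r ^ 2 * |w ^ (α / 2) - 1 - α / 2 * (w - 1)| ≤ r ^ 2 * (w - 1) ^ 2 := by gcongr
    nlinarith [sq_nonneg t]
  · rw [min_eq_right htr]
    have h3 : ‖q‖ ^ α ≤ r ^ α * (1 + t / r) := by
      calc ‖q‖ ^ α ≤ (r * (1 + t / r)) ^ α := by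
            apply Real.rpow_le_rpow (norm_nonneg _) _ h0.le
            rw [mul_add, mul_one, mul_div_cancel₀ _ hp.ne']; exact hqt
        _ = r ^ α * (1 + t / r) ^ α := Real.mul_rpow hp.le (by positivity)
        _ ≤ _ := by
            gcongr
            calc (1 + t / r) ^ α ≤ (1 + t / r) ^ (1:ℝ) := by
                  apply Real.rpow_le_rpow_of_exponent_le _ h1.le
                  have : 0 ≤ t / r := by positivity
                  linarith
              _ = _ := Real.rpow_one _
    have h4 : r ^ α * (1 + t / r) = A * (r ^ 2 + t * r) := by
      rw [hrα]; field_simp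
    have h5 : 0 ≤ ‖q‖ ^ α := by positivity
    have h6 : |α * A * I| ≤ A * (t * r) := by
      rw [abs_mul, abs_of_pos (by positivity : 0 < α * A)]
      have : α * (A * |I|) ≤ 1 * (A * (r * t)) := by gcongr
      linarith
    have h7 : A * r ^ 2 ≤ A * (t * r) := by gcongr; nlinarith
    have h8 : 0 ≤ A * (t * r) := by positivity
    have h9 : 0 ≤ A * r ^ 2 := by positivity
    rw [h4] at h3
    rw [hrα, abs_le]
    have := abs_le.1 h6
    constructor <;> nlinarith

/-- The model kernel. -/
noncomputable def Kfun (n : ℕ) (s : ℝ) (r t : ℝ) : ℝ :=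
  t * min t r * t ^ (-((n : ℝ) + 1 + s))

lemma Kfun_nonneg (n : ℕ) (s : ℝ) {r t : ℝ} (hr : 0 ≤ r) (ht : 0 ≤ t) : 0 ≤ Kfun n s r t := by
  unfold Kfun; positivity

lemma Kfun_integrable (n : ℕ) (hn : 2 ≤ n) (s : ℝ) (hs : s ∈ Set.Ioo (0:ℝ) 1) :
    Integrable (fun z : EuclideanSpace ℝ (Fin n) => Kfun n s 1 ‖z‖) := by
  have : Nonempty (Fin n) := ⟨⟨0, by omega⟩⟩
  rw [integrable_fun_norm_addHaar (volume : Measure (EuclideanSpace ℝ (Fin n)))]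
  rw [← Set.Ioc_union_Ioi_eq_Ioi (zero_le_one (α := ℝ)), finrank_euclideanSpace, Fintype.card_fin]
  have hpow : ∀ y : ℝ, 0 < y → y ^ (n - 1) = y ^ ((n:ℝ) - 1) := by
    intro y hy
    rw [← Real.rpow_natCast, Nat.cast_sub (by omega)]; simp
  refine IntegrableOn.union ?_ ?_
  · have h := (intervalIntegrable_iff_integrableOn_Ioc_of_le (zero_le_one (α := ℝ))).1
      (intervalIntegral.intervalIntegrable_rpow' (a := 0) (b := 1) (r := -s) (by linarith [hs.2]))
    refine h.congr_fun ?_ measurableSet_Ioc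
    intro y hy
    have hy0 : 0 < y := hy.1
    simp only [Kfun, smul_eq_mul]
    rw [min_eq_left hy.2, hpow y hy0]
    calc y ^ (-s) = y ^ ((n:ℝ) - 1 + (1 + 1 + -((n:ℝ) + 1 + s))) := by congr 1; ring
      _ = _ := by rw [Real.rpow_add hy0, Real.rpow_add hy0, Real.rpow_add hy0, Real.rpow_one]
  · have h := integrableOn_Ioi_rpow_of_lt (a := -1 - s) (by linarith [hs.1]) (zero_lt_one)
    refine h.congr_fun ?_ measurableSet_Ioi
    intro y hy
    have hy1 : 1 < y := hy
    have hy0 : 0 < y := by linarith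
    simp only [Kfun, smul_eq_mul]
    rw [min_eq_right hy1.le, hpow y hy0, mul_one]
    calc y ^ (-1-s) = y ^ ((n:ℝ) - 1 + (1 + -((n:ℝ) + 1 + s))) := by congr 1; ring
      _ = _ := by rw [Real.rpow_add hy0, Real.rpow_add hy0, Real.rpow_one]

lemma Kfun_scale (n : ℕ) (s : ℝ) {r t : ℝ} (hr : 0 < r) (ht : 0 ≤ t) :
    Kfun n s r t = r ^ (1 - s - n) * Kfun n s 1 (r⁻¹ * t) := by
  have h1 : min t r = r * min (r⁻¹ * t) 1 := by
    rw [mul_min_of_nonneg _ _ hr.le, mul_inv_cancel_left₀ hr.ne', mul_one]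
  unfold Kfun
  rw [h1, Real.mul_rpow (by positivity) ht, Real.inv_rpow hr.le, Real.rpow_neg hr.le, inv_inv]
  have h2 : r ^ (1 - s - n) = r * r * (r ^ ((n:ℝ) + 1 + s))⁻¹ := by
    rw [← Real.rpow_neg hr.le]
    calc _ = r ^ (1 + 1 + -((n:ℝ) + 1 + s)) := by congr 1; ring
      _ = _ := by rw [Real.rpow_add hr, Real.rpow_add hr, Real.rpow_one]
  have h3 : r ^ ((n:ℝ) + 1 + s) ≠ 0 := (Real.rpow_pos_of_pos hr _).ne'
  rw [h2]
  field_simp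

lemma Kfun_lintegral (n : ℕ) (hn : 2 ≤ n) (s : ℝ) (hs : s ∈ Set.Ioo (0:ℝ) 1) {r : ℝ} (hr : 0 < r) :
    ∫⁻ z : EuclideanSpace ℝ (Fin n), ENNReal.ofReal (Kfun n s r ‖z‖) =
      ENNReal.ofReal (r ^ (1 - s) * ∫ z : EuclideanSpace ℝ (Fin n), Kfun n s 1 ‖z‖) := by
  have hfe : ∀ z : EuclideanSpace ℝ (Fin n),
      Kfun n s r ‖z‖ = r ^ (1 - s - n) * Kfun n s 1 ‖r⁻¹ • z‖ := by
    intro z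
    rw [Kfun_scale n s hr (norm_nonneg z), norm_smul, Real.norm_of_nonneg (inv_nonneg.2 hr.le)]
  have hKint : Integrable (fun z : EuclideanSpace ℝ (Fin n) => Kfun n s r ‖z‖) := by
    simp_rw [hfe]
    exact (((integrable_comp_smul_iff volume
      (fun z : EuclideanSpace ℝ (Fin n) => Kfun n s 1 ‖z‖) (inv_ne_zero hr.ne')).2
      (Kfun_integrable n hn s hs))).const_mul _
  rw [← ofReal_integral_eq_lintegral_ofReal hKint
    (Eventually.of_forall fun z => Kfun_nonneg n s hr.le (norm_nonneg z))]
  congr 1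
  simp_rw [hfe]
  rw [integral_const_mul, Measure.integral_comp_inv_smul volume
    (fun z : EuclideanSpace ℝ (Fin n) => Kfun n s 1 ‖z‖) r, finrank_euclideanSpace, Fintype.card_fin,
    abs_of_pos (by positivity), smul_eq_mul, ← mul_assoc]
  congr 1
  rw [← Real.rpow_natCast, ← Real.rpow_add hr]; congr 1; ring

/-- Horizontal projection. -/
noncomputable def hpr {n : ℕ} (y : EuclideanSpace ℝ (Fin (n + 1))) : EuclideanSpace ℝ (Fin n) :=
  WithLp.toLp 2 (fun i => y i.castSucc)

lemma split_mp (n : ℕ) : MeasurePreserving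
    (fun y : EuclideanSpace ℝ (Fin (n + 1)) => (y (Fin.last n), hpr y))
    volume ((volume : Measure ℝ).prod (volume : Measure (EuclideanSpace ℝ (Fin n)))) := by
  have h1 := EuclideanSpace.volume_preserving_symm_measurableEquiv_toLp (Fin (n + 1))
  have h2 := volume_preserving_piFinSuccAbove (fun _ : Fin (n + 1) => ℝ) (Fin.last n)
  have h3 := (MeasurePreserving.id (volume : Measure ℝ)).prod
    (PiLp.volume_preserving_toLp (Fin n))
  have h := (h3.comp h2).comp h1
  have heq : (fun y : EuclideanSpace ℝ (Fin (n + 1)) => (y (Fin.last n), hpr y)) =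
      (Prod.map id (WithLp.toLp 2) ∘ (MeasurableEquiv.piFinSuccAbove (fun _ => ℝ) (Fin.last n))) ∘
      (MeasurableEquiv.toLp 2 (Fin (n + 1) → ℝ)).symm := by
    funext y
    refine Prod.ext rfl ?_
    change hpr y = WithLp.toLp 2 (fun i => y ((Fin.last n).succAbove i))
    simp [hpr, Fin.succAbove_last]
  rw [heq]
  exact h

lemma strip_lintegral (n : ℕ) (hn : 2 ≤ n) (s : ℝ) (hs : s ∈ Set.Ioo (0:ℝ) 1) {r M : ℝ}
    (hr : 0 < r) (hM : 0 ≤ M) (b : ℝ) (p v : EuclideanSpace ℝ (Fin n)) :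
    ∫⁻ y : EuclideanSpace ℝ (Fin (n + 1)),
      Set.indicator {y : EuclideanSpace ℝ (Fin (n + 1)) |
          |y (Fin.last n) - b - inner ℝ v (hpr y - p)| ≤
            M * (‖hpr y - p‖ * min ‖hpr y - p‖ r)}
        (fun y => ENNReal.ofReal (‖hpr y - p‖ ^ (-((n : ℝ) + 1 + s)))) y =
    ENNReal.ofReal (2 * M * (r ^ (1 - s) *
      ∫ z : EuclideanSpace ℝ (Fin n), Kfun n s 1 ‖z‖)) := by
  set S : Set (ℝ × EuclideanSpace ℝ (Fin n)) := {z | |z.1 - b - inner ℝ v (z.2 - p)| ≤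
            M * (‖z.2 - p‖ * min ‖z.2 - p‖ r)} with hS
  have hSm : MeasurableSet S := by
    apply measurableSet_le
    · apply Continuous.measurable; fun_prop
    · apply Continuous.measurable; fun_prop
  set G : ℝ × EuclideanSpace ℝ (Fin n) → ENNReal := S.indicator
    (fun z => ENNReal.ofReal (‖z.2 - p‖ ^ (-((n : ℝ) + 1 + s)))) with hG
  have hGm : Measurable G := by
    apply Measurable.indicator _ hSm
    fun_prop
  have h1 := (split_mp n).lintegral_comp hGm
  have h2 : (fun y : EuclideanSpace ℝ (Fin (n + 1)) => Set.indicator {y : EuclideanSpace ℝ (Fin (n + 1)) |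
          |y (Fin.last n) - b - inner ℝ v (hpr y - p)| ≤
            M * (‖hpr y - p‖ * min ‖hpr y - p‖ r)}
        (fun y => ENNReal.ofReal (‖hpr y - p‖ ^ (-((n : ℝ) + 1 + s)))) y) =
      fun y => G (y (Fin.last n), hpr y) := rfl
  rw [h2, h1, lintegral_prod_symm _ hGm.aemeasurable]
  have h3 : ∀ q : EuclideanSpace ℝ (Fin n), ∫⁻ a : ℝ, G (a, q) =
      ENNReal.ofReal (2 * M) * ENNReal.ofReal (Kfun n s r ‖q - p‖) := by
    intro q
    set t := ‖q - p‖ with ht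
    have ht0 : 0 ≤ t := norm_nonneg _
    set c := b + inner ℝ v (q - p) with hc
    set e := M * (t * min t r) with he
    have h4 : (fun a : ℝ => G (a, q)) = (Set.Icc (c - e) (c + e)).indicator
        (fun _ => ENNReal.ofReal (t ^ (-((n : ℝ) + 1 + s)))) := by
      ext a
      simp only [hG, Set.indicator_apply]
      congr 1
      simp only [hS, Set.mem_ofPred_eq, Set.mem_Icc, abs_le, eq_iff_iff]
      rw [← ht]
      constructor <;> rintro ⟨h, h'⟩ <;> constructor <;> linarith
    rw [h4, lintegral_indicator_const measurableSet_Icc, Real.volume_Icc,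
      ← ENNReal.ofReal_mul (by positivity), ← ENNReal.ofReal_mul (by positivity)]
    congr 1
    unfold Kfun
    ring
  simp_rw [h3]
  rw [lintegral_const_mul' _ _ ENNReal.ofReal_ne_top,
    lintegral_sub_right_eq_self (fun q : EuclideanSpace ℝ (Fin n) => ENNReal.ofReal (Kfun n s r ‖q‖)) p,
    Kfun_lintegral n hn s hs hr, ← ENNReal.ofReal_mul (by positivity)]

lemma mem_powerSubgraph (n : ℕ) (α : ℝ) (y : EuclideanSpace ℝ (Fin (n + 1))) :
    y ∈ powerSubgraph n α ↔ y (Fin.last n) < ‖hpr y‖ ^ α := by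
  simp [powerSubgraph, hpr, EuclideanSpace.norm_eq]

lemma hpr_norm_sq {n : ℕ} (y : EuclideanSpace ℝ (Fin (n + 1))) :
    ‖y‖ ^ 2 = ‖hpr y‖ ^ 2 + (y (Fin.last n)) ^ 2 := by
  rw [EuclideanSpace.real_norm_sq_eq, EuclideanSpace.real_norm_sq_eq, Fin.sum_univ_castSucc]
  rfl

lemma hpr_sub {n : ℕ} (y z : EuclideanSpace ℝ (Fin (n + 1))) : hpr (y - z) = hpr y - hpr z := by
  ext i; simp [hpr]

lemma hpr_norm_le {n : ℕ} (y : EuclideanSpace ℝ (Fin (n + 1))) : ‖hpr y‖ ≤ ‖y‖ := by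
  refine (sq_le_sq₀ (norm_nonneg _) (norm_nonneg _)).1 ?_
  rw [hpr_norm_sq y]; nlinarith [sq_nonneg (y (Fin.last n))]

lemma nmc_abs_le (n : ℕ) (s : ℝ) (A : Set (EuclideanSpace ℝ (Fin (n + 1))))
    (x y : EuclideanSpace ℝ (Fin (n + 1))) :
    |nmcIntegrand n s A x y| ≤ ‖x - y‖ ^ (-((n : ℝ) + 1 + s)) := by
  unfold nmcIntegrand
  rw [abs_mul, abs_of_nonneg (by positivity : 0 ≤ ‖x - y‖ ^ (-((n : ℝ) + 1 + s)))]
  by_cases h : y ∈ A <;> simp [h]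

lemma trunc_bound (n : ℕ) (hn : 2 ≤ n) (s α : ℝ)
    (hs : s ∈ Set.Ioo (0:ℝ) 1) (hα : α ∈ Set.Ioo (0:ℝ) 1) (x : EuclideanSpace ℝ (Fin (n + 1)))
    (hx : x (Fin.last n) = ‖hpr x‖ ^ α) (hr : 0 < ‖hpr x‖) (ε : ℝ) :
    |∫ y in (Metric.ball x ε)ᶜ, nmcIntegrand n s (powerSubgraph n α) x y| ≤
      20 * (∫ z : EuclideanSpace ℝ (Fin n), Kfun n s 1 ‖z‖) * ‖hpr x‖ ^ (α - 1 - s) := by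
  set F := powerSubgraph n α with hF
  set p := hpr x with hp
  set r := ‖p‖ with hrdef
  set κ := ∫ z : EuclideanSpace ℝ (Fin n), Kfun n s 1 ‖z‖ with hκ
  have hκ0 : 0 ≤ κ := integral_nonneg fun z => Kfun_nonneg n s zero_le_one (norm_nonneg z)
  have hrp : 0 < r ^ (α - 2) := Real.rpow_pos_of_pos hr _
  set M := 10 * r ^ (α - 2) with hM
  have hM0 : 0 < M := by positivity
  set v : EuclideanSpace ℝ (Fin n) := (α * r ^ (α - 2)) • p with hv
  rw [← integral_indicator Metric.isOpen_ball.measurableSet.compl]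
  set g := (Metric.ball x ε)ᶜ.indicator (nmcIntegrand n s F x) with hg
  have hg1 : ∀ y, |g y| ≤ ‖x - y‖ ^ (-((n : ℝ) + 1 + s)) := by
    intro y
    by_cases hb : y ∈ (Metric.ball x ε)ᶜ
    · rw [hg, Set.indicator_of_mem hb]; exact nmc_abs_le n s F x y
    · rw [hg, Set.indicator_of_notMem hb, abs_zero]; positivity
  by_cases hgi : Integrable g
  swap
  · rw [integral_undef hgi, abs_zero]; positivity
  have hgi' : Integrable (fun y => g (x + x - y)) := hgi.comp_sub_left (x + x)
  have h2I : 2 * ∫ y, g y = ∫ y, (g y + g (x + x - y)) := by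
    rw [integral_add hgi hgi', integral_sub_left_eq_self g volume (x + x)]; ring
  set S := {y : EuclideanSpace ℝ (Fin (n + 1)) |
          |y (Fin.last n) - x (Fin.last n) - inner ℝ v (hpr y - p)| ≤
            M * (‖hpr y - p‖ * min ‖hpr y - p‖ r)} with hS
  have hrefl : ∀ y, x - (x + x - y) = -(x - y) := fun y => by abel
  have hpt : ∀ y, ENNReal.ofReal ‖g y + g (x + x - y)‖ ≤ 2 *
      S.indicator (fun y => ENNReal.ofReal (‖hpr y - p‖ ^ (-((n : ℝ) + 1 + s)))) y := by
    intro y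
    by_cases hy : y ∈ S
    · have h22 : (2 : ENNReal) * ENNReal.ofReal (‖hpr y - p‖ ^ (-((n : ℝ) + 1 + s))) =
          ENNReal.ofReal (2 * ‖hpr y - p‖ ^ (-((n : ℝ) + 1 + s))) := by
        rw [ENNReal.ofReal_mul (by norm_num)]; simp
      rw [Set.indicator_of_mem hy, h22]
      apply ENNReal.ofReal_le_ofReal
      have h1 := hg1 y
      have h2 := hg1 (x + x - y)
      rw [hrefl, norm_neg] at h2
      have h3 : ‖x - y‖ ^ (-((n : ℝ) + 1 + s)) ≤ ‖hpr y - p‖ ^ (-((n : ℝ) + 1 + s)) := by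
        by_cases hyp : hpr y = p
        · have hxy : x - y = 0 := by
            have hy' : |y (Fin.last n) - x (Fin.last n) - inner ℝ v (hpr y - p)| ≤
              M * (‖hpr y - p‖ * min ‖hpr y - p‖ r) := hy
            simp only [hyp, sub_self, inner_zero_right, norm_zero, zero_mul, mul_zero,
              sub_zero] at hy'
            have h4 := abs_nonpos_iff.1 hy'
            have h5 := hpr_norm_sq (x - y)
            rw [hpr_sub, hyp, ← hp, sub_self, norm_zero] at h5
            have h6 : (x - y) (Fin.last n) = 0 := by
              simp only [PiLp.sub_apply]; linarith
            rw [h6] at h5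
            have : ‖x - y‖ = 0 := by nlinarith [norm_nonneg (x - y)]
            exact norm_eq_zero.1 this
          rw [hxy, hyp]; simp
        · have h0 : 0 < ‖hpr y - p‖ := norm_pos_iff.2 (sub_ne_zero.2 hyp)
          apply Real.rpow_le_rpow_of_nonpos h0
          · rw [hp, ← hpr_sub, norm_sub_rev]; exact hpr_norm_le _
          · have := hs.1
            have : (0:ℝ) ≤ n := by positivity
            linarith
      rw [Real.norm_eq_abs]
      linarith [abs_add_le (g y) (g (x + x - y))]
    · have hz : g y + g (x + x - y) = 0 := by
        have hball : x + x - y ∈ (Metric.ball x ε)ᶜ ↔ y ∈ (Metric.ball x ε)ᶜ := by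
          simp only [Set.mem_compl_iff, Metric.mem_ball, dist_eq_norm]
          rw [show x + x - y - x = -(y - x) by abel, norm_neg]
        by_cases hb : y ∈ (Metric.ball x ε)ᶜ
        swap
        · simp only [hg]
          rw [Set.indicator_of_notMem hb, Set.indicator_of_notMem (fun h => hb (hball.1 h)), add_zero]
        simp only [hg]
        rw [Set.indicator_of_mem hb, Set.indicator_of_mem (hball.2 hb)]
        have hpy : hpr (x + x - y) - p = -(hpr y - p) := by
          ext i; simp [hpr, hp]; ring
        have hly : (x + x - y) (Fin.last n) = 2 * x (Fin.last n) - y (Fin.last n) := by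
          simp; ring
        have hy' : ¬ (|y (Fin.last n) - x (Fin.last n) - inner ℝ v (hpr y - p)| ≤
              M * (‖hpr y - p‖ * min ‖hpr y - p‖ r)) := hy
        rw [not_le] at hy'
        have e1 := tangent_bound hα.1 hα.2 p (hpr y) hr
        have e2 := tangent_bound hα.1 hα.2 p (hpr (x + x - y)) hr
        have hvi : ∀ w, α * r ^ (α - 2) * inner ℝ p w = inner ℝ v w := by
          intro w; rw [hv, real_inner_smul_left]
        rw [hvi] at e1 e2
        rw [hpy, inner_neg_right, norm_neg] at e2
        rw [← hrdef, ← hx] at e1 e2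
        have m1 := mem_powerSubgraph n α y
        have m2 := mem_powerSubgraph n α (x + x - y)
        rw [hly] at m2
        rw [← hF] at m1 m2
        have e1' := abs_le.1 e1
        have e2' := abs_le.1 e2
        unfold nmcIntegrand
        rw [hrefl, norm_neg, ← add_mul]
        rcases lt_abs.1 hy' with h | h
        · have n1 : y ∉ F := by rw [m1]; linarith
          have n2 : x + x - y ∈ F := by rw [m2]; linarith
          simp [n1, n2]
        · have n1 : y ∈ F := by rw [m1]; linarith
          have n2 : x + x - y ∉ F := by rw [m2]; linarith
          simp [n1, n2]
      rw [hz]; simp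
  have hfin : |2 * ∫ y, g y| ≤ 2 * (2 * M * (r ^ (1 - s) * κ)) := by
    rw [h2I, ← Real.norm_eq_abs]
    refine (norm_integral_le_lintegral_norm _).trans ?_
    apply ENNReal.toReal_le_of_le_ofReal (by positivity)
    refine (lintegral_mono hpt).trans ?_
    rw [lintegral_const_mul' _ _ (by simp), strip_lintegral n hn s hs hr hM0.le,
      ENNReal.ofReal_mul (p := 2) (by norm_num)]
    simp [hκ]
  have hpw : r ^ (α - 2) * r ^ (1 - s) = r ^ (α - 1 - s) := by
    rw [← Real.rpow_add hr]; congr 1; ring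
  rw [abs_mul, abs_two] at hfin
  calc |∫ y, g y| ≤ 2 * M * (r ^ (1 - s) * κ) := by linarith
    _ = 20 * κ * (r ^ (α - 2) * r ^ (1 - s)) := by rw [hM]; ring
    _ = _ := by rw [hpw]

lemma base_lower {n : ℕ} {α : ℝ} (hα : α ∈ Set.Ioo (0:ℝ) 1) (x : EuclideanSpace ℝ (Fin (n + 1)))
    (hx : x (Fin.last n) = ‖hpr x‖ ^ α) (h1 : 1 ≤ ‖x‖) :
    ‖x‖ ≤ 2 * 2 ^ (1 / α) * ‖hpr x‖ := by
  have hα0 := hα.1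
  set r := ‖hpr x‖ with hr
  have hr0 : 0 ≤ r := norm_nonneg _
  have hrα : 0 ≤ r ^ α := by positivity
  have hsum : ‖x‖ ≤ r + r ^ α := by
    refine (sq_le_sq₀ (norm_nonneg _) (by positivity)).1 ?_
    rw [hpr_norm_sq x, hx]; nlinarith [mul_nonneg hr0 hrα]
  have h2 : (1:ℝ) ≤ 2 ^ (1 / α) := Real.one_le_rpow (by norm_num) (by positivity)
  rcases le_total 1 r with h | h
  · have : r ^ α ≤ r := by
      calc r ^ α ≤ r ^ (1:ℝ) := Real.rpow_le_rpow_of_exponent_le h hα.2.le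
        _ = r := Real.rpow_one r
    nlinarith
  · have h3 : r ≤ r ^ α := by
      rcases hr0.eq_or_lt with h0 | h0
      · rw [← h0]; positivity
      calc r = r ^ (1:ℝ) := (Real.rpow_one r).symm
        _ ≤ r ^ α := Real.rpow_le_rpow_of_exponent_ge h0 h hα.2.le
    have h4 : 1 ≤ 2 * r ^ α := by linarith
    have h5 : 1 ≤ 2 ^ (1 / α) * r := by
      have := Real.one_le_rpow h4 (by positivity : 0 ≤ 1 / α)
      rwa [Real.mul_rpow (by norm_num) hrα, ← Real.rpow_mul hr0, mul_one_div_cancel hα0.ne',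
        Real.rpow_one] at this
    have h6 : r ^ α ≤ 1 := Real.rpow_le_one hr0 h hα0.le
    linarith

theorem barrier_curvature_decay (n : ℕ) (hn : 2 ≤ n) (s α : ℝ)
    (hs : s ∈ Set.Ioo (0:ℝ) 1) (hα : α ∈ Set.Ioo (0:ℝ) 1) :
    ∃ C : ℝ, 1 ≤ C ∧
      ∀ x : EuclideanSpace ℝ (Fin (n + 1)), x ∈ frontier (powerSubgraph n α) → 1 ≤ ‖x‖ →
        ∀ L : ℝ, HasFracMeanCurv n s (powerSubgraph n α) x L →
          |L| ≤ C * ‖x‖ ^ (α - 1 - s) := by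
  set κ := ∫ z : EuclideanSpace ℝ (Fin n), Kfun n s 1 ‖z‖ with hκ
  have hκ0 : 0 ≤ κ := integral_nonneg fun z => Kfun_nonneg n s zero_le_one (norm_nonneg z)
  set A : ℝ := 2 * 2 ^ (1 / α) with hA
  have hA0 : 0 < A := by positivity
  refine ⟨max 1 (20 * κ * A ^ (-(α - 1 - s))), le_max_left _ _, ?_⟩
  intro x hxF hx1 L hL
  have hx : x (Fin.last n) = ‖hpr x‖ ^ α := by
    have hc1 : Continuous fun x : EuclideanSpace ℝ (Fin (n + 1)) => x (Fin.last n) := by fun_prop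
    have hc2 : Continuous fun x : EuclideanSpace ℝ (Fin (n + 1)) =>
        (Real.sqrt (∑ i : Fin n, (x i.castSucc) ^ 2)) ^ α :=
      Continuous.rpow_const (by fun_prop) (fun _ => Or.inr hα.1.le)
    have h := frontier_lt_subset_eq hc1 hc2 hxF
    have h' : x (Fin.last n) = (Real.sqrt (∑ i : Fin n, (x i.castSucc) ^ 2)) ^ α := h
    rw [h']
    simp [hpr, EuclideanSpace.norm_eq]
  have hb := base_lower hα x hx hx1
  have hr : 0 < ‖hpr x‖ := by
    by_contra hcon
    have : ‖hpr x‖ = 0 := le_antisymm (not_lt.1 hcon) (norm_nonneg _)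
    rw [this] at hb
    linarith
  have hx0 : 0 < ‖x‖ := by linarith
  have hle : |L| ≤ 20 * κ * ‖hpr x‖ ^ (α - 1 - s) := by
    refine le_of_tendsto hL.abs (Eventually.of_forall fun ε => ?_)
    exact trunc_bound n hn s α hs hα x hx hr ε
  have hpow : ‖hpr x‖ ^ (α - 1 - s) ≤ A ^ (-(α - 1 - s)) * ‖x‖ ^ (α - 1 - s) := by
    have h1 : (A * ‖hpr x‖) ^ (α - 1 - s) ≤ ‖x‖ ^ (α - 1 - s) :=
      Real.rpow_le_rpow_of_nonpos hx0 hb (by linarith [hα.2, hs.1])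
    rw [Real.mul_rpow hA0.le hr.le] at h1
    have h2 : 0 < A ^ (α - 1 - s) := Real.rpow_pos_of_pos hA0 _
    rw [Real.rpow_neg hA0.le, inv_mul_eq_div, le_div_iff₀ h2]
    linarith
  calc |L| ≤ 20 * κ * ‖hpr x‖ ^ (α - 1 - s) := hle
    _ ≤ 20 * κ * (A ^ (-(α - 1 - s)) * ‖x‖ ^ (α - 1 - s)) := by gcongr
    _ = (20 * κ * A ^ (-(α - 1 - s))) * ‖x‖ ^ (α - 1 - s) := by ring
    _ ≤ _ := by gcongr; exact le_max_right _ _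
end
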